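/- With Γ(x,t) = I_p + 𝒬(x,t)𝒩(x), where 𝒬(x,t) = e^{−Aᵀx} e^{8(Aᵀ)³t} Q e^{−Ax} e^{8A³t} and 𝒩(x) = e^{−Ax} N e^{−Aᵀx}, the matrix Γ(x,t) is invertible for all (x,t), and its inverse satisfies the differential identity ∂/∂x (Γ(x,t)⁻¹) = Γ⁻¹Aᵀ + AᵀΓ⁻¹ − 2Γ⁻¹(Aᵀ − 𝒬(x,t) A 𝒩(x))Γ⁻¹. -/

import Mathlib

open Matrix MeasureTheory Filter

noncomputable def mexp {p : ℕ} (M : Matrix (Fin p) (Fin p) ℝ) : Matrix (Fin p) (Fin p) ℝ :=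
  ∑' k : ℕ, (k.factorial : ℝ)⁻¹ • M ^ k

def EigPos {p : ℕ} (A : Matrix (Fin p) (Fin p) ℝ) : Prop :=
  ∀ μ ∈ spectrum ℂ (A.map Complex.ofReal), 0 < μ.re

def Observable {p : ℕ} (A : Matrix (Fin p) (Fin p) ℝ) (C : Matrix (Fin 1) (Fin p) ℝ) : Prop :=
  ∀ v : Fin p → ℝ, (∀ r : ℕ, (C * A ^ r) *ᵥ v = 0) → v = 0

def Controllable {p : ℕ} (A : Matrix (Fin p) (Fin p) ℝ) (B : Matrix (Fin p) (Fin 1) ℝ) : Prop :=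
  ∀ v : Fin p → ℝ, (∀ r : ℕ, (Bᵀ * Aᵀ ^ r) *ᵥ v = 0) → v = 0

noncomputable def Qmat {p : ℕ} (A : Matrix (Fin p) (Fin p) ℝ) (C : Matrix (Fin 1) (Fin p) ℝ) :
    Matrix (Fin p) (Fin p) ℝ :=
  Matrix.of fun i j =>
    ∫ s in Set.Ioi (0 : ℝ), (mexp (-(s • Aᵀ)) * (Cᵀ * C) * mexp (-(s • A))) i j

noncomputable def Nmat {p : ℕ} (A : Matrix (Fin p) (Fin p) ℝ) (B : Matrix (Fin p) (Fin 1) ℝ) :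
    Matrix (Fin p) (Fin p) ℝ :=
  Matrix.of fun i j =>
    ∫ s in Set.Ioi (0 : ℝ), (mexp (-(s • A)) * (B * Bᵀ) * mexp (-(s • Aᵀ))) i j

noncomputable def Pmat {p : ℕ} (A : Matrix (Fin p) (Fin p) ℝ) (B : Matrix (Fin p) (Fin 1) ℝ)
    (C : Matrix (Fin 1) (Fin p) ℝ) : Matrix (Fin p) (Fin p) ℝ :=
  Matrix.of fun i j =>
    ∫ s in Set.Ioi (0 : ℝ), (mexp (-(s • A)) * (B * C) * mexp (-(s • A))) i j

noncomputable def Fmat {p : ℕ} (A : Matrix (Fin p) (Fin p) ℝ) (B : Matrix (Fin p) (Fin 1) ℝ)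
    (C : Matrix (Fin 1) (Fin p) ℝ) (x t : ℝ) : Matrix (Fin p) (Fin p) ℝ :=
  mexp ((2 * x) • Aᵀ - (8 * t) • Aᵀ ^ 3) +
    Qmat A C * mexp (-((2 * x) • A) + (8 * t) • A ^ 3) * Nmat A B

noncomputable def Emat {p : ℕ} (A : Matrix (Fin p) (Fin p) ℝ) (B : Matrix (Fin p) (Fin 1) ℝ)
    (C : Matrix (Fin 1) (Fin p) ℝ) (x t : ℝ) : Matrix (Fin p) (Fin p) ℝ :=
  mexp ((2 * x) • A - (8 * t) • A ^ 3) +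
    Pmat A B C * mexp (-((2 * x) • A) + (8 * t) • A ^ 3) * Pmat A B C

noncomputable def uFun {p : ℕ} (A : Matrix (Fin p) (Fin p) ℝ) (B : Matrix (Fin p) (Fin 1) ℝ)
    (C : Matrix (Fin 1) (Fin p) ℝ) (x t : ℝ) : ℝ :=
  -2 * ((Bᵀ * (Fmat A B C x t)⁻¹ * Cᵀ : Matrix (Fin 1) (Fin 1) ℝ) 0 0)

noncomputable def vFun {p : ℕ} (A : Matrix (Fin p) (Fin p) ℝ) (B : Matrix (Fin p) (Fin 1) ℝ)
    (C : Matrix (Fin 1) (Fin p) ℝ) (x t : ℝ) : ℝ :=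
  -2 * ((C * (Emat A B C x t)⁻¹ * B : Matrix (Fin 1) (Fin 1) ℝ) 0 0)

noncomputable def calQ {p : ℕ} (A : Matrix (Fin p) (Fin p) ℝ) (C : Matrix (Fin 1) (Fin p) ℝ)
    (x t : ℝ) : Matrix (Fin p) (Fin p) ℝ :=
  mexp (-(x • Aᵀ)) * mexp ((8 * t) • Aᵀ ^ 3) * Qmat A C * mexp (-(x • A)) * mexp ((8 * t) • A ^ 3)

noncomputable def calN {p : ℕ} (A : Matrix (Fin p) (Fin p) ℝ) (B : Matrix (Fin p) (Fin 1) ℝ)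
    (x : ℝ) : Matrix (Fin p) (Fin p) ℝ :=
  mexp (-(x • A)) * Nmat A B * mexp (-(x • Aᵀ))

noncomputable def Gam {p : ℕ} (A : Matrix (Fin p) (Fin p) ℝ) (B : Matrix (Fin p) (Fin 1) ℝ)
    (C : Matrix (Fin 1) (Fin p) ℝ) (x t : ℝ) : Matrix (Fin p) (Fin p) ℝ :=
  1 + calQ A C x t * calN A B x

noncomputable def Om {p : ℕ} (A : Matrix (Fin p) (Fin p) ℝ) (B : Matrix (Fin p) (Fin 1) ℝ)
    (C : Matrix (Fin 1) (Fin p) ℝ) (w t : ℝ) : ℝ :=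
  ((C * mexp (-(w • A)) * mexp ((8 * t) • A ^ 3) * B : Matrix (Fin 1) (Fin 1) ℝ) 0 0)

noncomputable def Kker {p : ℕ} (A : Matrix (Fin p) (Fin p) ℝ) (B : Matrix (Fin p) (Fin 1) ℝ)
    (C : Matrix (Fin 1) (Fin p) ℝ) (x y t : ℝ) : ℝ :=
  ((Bᵀ * (Fmat A B C x t)⁻¹ * mexp (-((y - x) • Aᵀ)) * Cᵀ : Matrix (Fin 1) (Fin 1) ℝ) 0 0)

open scoped Matrix.Norms.Operator in
lemma mexp_eq {p : ℕ} (M : Matrix (Fin p) (Fin p) ℝ) : mexp M = NormedSpace.exp M := by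
  rw [NormedSpace.exp_eq_tsum ℝ]; rfl

lemma mexp_transpose {p : ℕ} (M : Matrix (Fin p) (Fin p) ℝ) : mexp Mᵀ = (mexp M)ᵀ := by
  rw [mexp_eq, mexp_eq, Matrix.exp_transpose]

def Dec {E : Type*} [Norm E] (f : ℝ → E) : Prop :=
  ∃ ε : ℝ, 0 < ε ∧ f =O[atTop] fun s => Real.exp (-ε * s)

lemma dec_mono {E : Type*} [Norm E] {f : ℝ → E} {a b : ℝ} (h : a ≤ b)
    (hf : f =O[atTop] fun s => Real.exp (-b * s)) : f =O[atTop] fun s => Real.exp (-a * s) := by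
  refine hf.trans (Asymptotics.IsBigO.of_bound 1 ?_)
  filter_upwards [eventually_ge_atTop 0] with s hs
  simp only [Real.norm_eq_abs, Real.abs_exp, one_mul]
  apply Real.exp_le_exp.2
  nlinarith

lemma Dec.add {E : Type*} [SeminormedAddCommGroup E] {f g : ℝ → E} (hf : Dec f) (hg : Dec g) :
    Dec (fun s => f s + g s) := by
  obtain ⟨a, ha, hf⟩ := hf
  obtain ⟨b, hb, hg⟩ := hg
  exact ⟨min a b, lt_min ha hb, (dec_mono (min_le_left _ _) hf).add (dec_mono (min_le_right _ _) hg)⟩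

lemma Dec.zero {E : Type*} [SeminormedAddCommGroup E] : Dec (fun _ : ℝ => (0 : E)) :=
  ⟨1, one_pos, Asymptotics.isBigO_zero _ _⟩

lemma Dec.sum {ι E : Type*} [SeminormedAddCommGroup E] (S : Finset ι) {f : ι → ℝ → E}
    (hf : ∀ i, Dec (f i)) : Dec (fun s => ∑ i ∈ S, f i s) := by
  classical
  induction S using Finset.induction_on with
  | empty => simpa using Dec.zero
  | insert a S ha ih => simpa [Finset.sum_insert ha] using (hf a).add ih

lemma Dec.const_mul {f : ℝ → ℝ} (hf : Dec f) (c : ℝ) : Dec (fun s => c * f s) := by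
  obtain ⟨a, ha, hf⟩ := hf
  exact ⟨a, ha, hf.const_mul_left c⟩

lemma Dec.mul {f g : ℝ → ℝ} (hf : Dec f) (hg : Dec g) : Dec (fun s => f s * g s) := by
  obtain ⟨a, ha, hf⟩ := hf
  obtain ⟨b, hb, hg⟩ := hg
  refine ⟨a + b, add_pos ha hb, (hf.mul hg).congr_right fun s => ?_⟩
  rw [← Real.exp_add]; ring_nf

lemma dec_term {E : Type*} [NormedAddCommGroup E] [NormedSpace ℂ E] (μ : ℂ) (hμ : 0 < μ.re)
    (n : ℕ) (c : ℂ) (w : E) :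
    Dec (fun s : ℝ => (Complex.exp (-(s : ℂ) * μ) * (c * (-(s : ℂ)) ^ n)) • w) := by
  refine ⟨μ.re / 2, by positivity, ?_⟩
  have h1 : (fun s : ℝ => s ^ n) =O[atTop] fun s => Real.exp (μ.re / 2 * s) :=
    (isLittleO_pow_exp_pos_mul_atTop n (by positivity)).isBigO
  have h2 : (fun s : ℝ => Complex.exp (-(s : ℂ) * μ)) =O[atTop] fun s => Real.exp (-μ.re * s) := by
    refine Asymptotics.IsBigO.of_bound 1 (Eventually.of_forall fun s => ?_)
    simp [Complex.norm_exp, mul_comm]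
  have h3 : (fun s : ℝ => c * (-(s : ℂ)) ^ n) =O[atTop] fun s => Real.exp (μ.re / 2 * s) := by
    apply Asymptotics.IsBigO.const_mul_left
    refine (Asymptotics.IsBigO.of_bound 1 (Eventually.of_forall fun s => ?_)).trans h1
    simp
  have h4 := (h2.mul h3).smul (Asymptotics.isBigO_refl (fun _ : ℝ => w) atTop)
  refine h4.trans ((Asymptotics.IsBigO.of_bound ‖w‖ (Eventually.of_forall fun s => ?_)))
  rw [norm_smul, mul_comm, ← Real.exp_add]
  apply mul_le_mul_of_nonneg_left _ (norm_nonneg _)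
  apply le_of_eq; congr 2; ring

open scoped Matrix.Norms.Operator in
lemma dec_gen {p : ℕ} (A : Matrix (Fin p) (Fin p) ℂ) (μ : ℂ) (hμ : 0 < μ.re) (k : ℕ)
    (v : Fin p → ℂ) (hv : (A - μ • 1) ^ k *ᵥ v = 0) :
    Dec (fun s : ℝ => NormedSpace.exp (-(s : ℂ) • A) *ᵥ v) := by
  have key : ∀ s : ℝ, NormedSpace.exp (-(s : ℂ) • A) *ᵥ v =
      ∑ n ∈ Finset.range k, (Complex.exp (-(s : ℂ) * μ) * ((n.factorial : ℂ)⁻¹ * (-(s : ℂ)) ^ n)) •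
        ((A - μ • 1) ^ n *ᵥ v) := by
    intro s
    have e1 : -(s : ℂ) • A = algebraMap ℂ (Matrix (Fin p) (Fin p) ℂ) (-(s : ℂ) * μ)
        + -(s : ℂ) • (A - μ • 1) := by
      rw [Algebra.algebraMap_eq_smul_one, smul_sub, smul_smul]; abel
    have e0 : NormedSpace.exp (algebraMap ℂ (Matrix (Fin p) (Fin p) ℂ) (-(s : ℂ) * μ)) =
        algebraMap ℂ (Matrix (Fin p) (Fin p) ℂ) (NormedSpace.exp (-(s : ℂ) * μ)) :=
      (NormedSpace.algebraMap_exp_comm (𝕂 := ℂ) (𝔸 := Matrix (Fin p) (Fin p) ℂ) _).symm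
    have e2 : NormedSpace.exp (-(s : ℂ) • A) = Complex.exp (-(s : ℂ) * μ) •
        NormedSpace.exp (-(s : ℂ) • (A - μ • 1)) := by
      rw [e1, Matrix.exp_add_of_commute _ _ (Algebra.commute_algebraMap_left _ _), e0,
        ← Complex.exp_eq_exp_ℂ, ← Algebra.smul_def]
    have e3 : HasSum (fun n : ℕ => ((n.factorial : ℂ)⁻¹ • (-(s : ℂ) • (A - μ • 1)) ^ n) *ᵥ v)
        (NormedSpace.exp (-(s : ℂ) • (A - μ • 1)) *ᵥ v) := by
      have := NormedSpace.exp_series_hasSum_exp' (𝕂 := ℂ) (-(s : ℂ) • (A - μ • 1))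
      exact this.map (AddMonoidHom.mk' (fun M : Matrix (Fin p) (Fin p) ℂ => M *ᵥ v)
        (fun a b => Matrix.add_mulVec a b v)) (by
          show Continuous fun M : Matrix (Fin p) (Fin p) ℂ => M *ᵥ v
          fun_prop)
    have e4 := e3.unique (hasSum_sum_of_ne_finset_zero (s := Finset.range k) (fun n hn => by
      have hkn : k ≤ n := by simpa using hn
      obtain ⟨m, rfl⟩ := Nat.exists_eq_add_of_le hkn
      rw [smul_pow, smul_mulVec, smul_mulVec, add_comm k m,
        pow_add (A - μ • 1), ← mulVec_mulVec, hv]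
      simp))
    rw [e2, smul_mulVec, e4, Finset.smul_sum]
    refine Finset.sum_congr rfl fun n _ => ?_
    rw [smul_pow, smul_mulVec, smul_mulVec, smul_smul, smul_smul, mul_assoc]
  simp_rw [key]
  exact Dec.sum _ fun n => dec_term μ hμ n _ _

lemma dec_all {p : ℕ} (A : Matrix (Fin p) (Fin p) ℂ) (hA : ∀ μ ∈ spectrum ℂ A, 0 < μ.re)
    (v : Fin p → ℂ) : Dec (fun s : ℝ => NormedSpace.exp (-(s : ℂ) • A) *ᵥ v) := by
  have hv : v ∈ ⨆ μ : ℂ, Module.End.maxGenEigenspace (Matrix.toLin' A) μ := by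
    rw [Module.End.iSup_maxGenEigenspace_eq_top]; trivial
  induction hv using Submodule.iSup_induction' with
  | zero => simpa using Dec.zero
  | add x y _ _ hx hy => simpa [mulVec_add] using hx.add hy
  | mem μ x hx =>
    rw [Module.End.mem_maxGenEigenspace] at hx
    obtain ⟨k, hk⟩ := hx
    have hk' : (A - μ • 1) ^ k *ᵥ x = 0 := by
      rw [← hk, ← Matrix.toLin'_apply, Matrix.toLin'_pow]
      simp
      rfl
    by_cases hμ : μ ∈ spectrum ℂ A
    · exact dec_gen A μ (hA μ hμ) k x hk'
    · have hu : IsUnit (A - μ • 1) := by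
        rw [spectrum.notMem_iff, ← IsUnit.neg_iff] at hμ
        simpa [Algebra.algebraMap_eq_smul_one] using hμ
      have hx0 : x = 0 := by
        have hu' := hu.pow k
        have := (Matrix.mulVec_injective_iff_isUnit.2 hu') (a₁ := x) (a₂ := 0) (by simpa using hk')
        exact this
      subst hx0
      simpa using Dec.zero

lemma map_mexp {p : ℕ} (A : Matrix (Fin p) (Fin p) ℝ) (s : ℝ) :
    (mexp (-(s • A))).map Complex.ofReal = NormedSpace.exp (-(s : ℂ) • A.map Complex.ofReal) := by
  open scoped Matrix.Norms.Operator in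
  rw [mexp_eq]
  have := NormedSpace.map_exp (Complex.ofRealHom.mapMatrix (m := Fin p))
    (by
      show Continuous fun M : Matrix (Fin p) (Fin p) ℝ => M.map Complex.ofReal
      exact continuous_id.matrix_map Complex.continuous_ofReal) (-(s • A))
  refine this.trans ?_
  congr 1
  ext i j
  simp

lemma dec_mexp {p : ℕ} (A : Matrix (Fin p) (Fin p) ℝ) (hA : EigPos A) (i j : Fin p) :
    Dec (fun s : ℝ => mexp (-(s • A)) i j) := by
  obtain ⟨ε, hε, h⟩ := dec_all _ hA (Pi.single j 1)
  refine ⟨ε, hε, (Asymptotics.IsBigO.of_bound 1 (Eventually.of_forall fun s => ?_)).trans h⟩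
  rw [← map_mexp, one_mul]
  refine le_trans (le_of_eq ?_) (norm_le_pi_norm _ i)
  simp

open scoped Matrix.Norms.Operator in
lemma hasDeriv_mexp {p : ℕ} (A : Matrix (Fin p) (Fin p) ℝ) (x : ℝ) :
    HasDerivAt (fun s : ℝ => mexp (-(s • A))) (-(A * mexp (-(x • A)))) x := by
  have := hasDerivAt_exp_smul_const' (𝕂 := ℝ) (-A) x
  simp only [smul_neg, neg_mul] at this
  simp only [mexp_eq]
  exact this

lemma cont_mexp {p : ℕ} (A : Matrix (Fin p) (Fin p) ℝ) :
    Continuous (fun s : ℝ => mexp (-(s • A))) := by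
  open scoped Matrix.Norms.Operator in
  exact continuous_iff_continuousAt.2 fun x => (hasDeriv_mexp A x).continuousAt

lemma psd_int {p : ℕ} (G : ℝ → Matrix (Fin 1) (Fin p) ℝ) (hG : Continuous G)
    (hd : ∀ j, Dec (fun s => G s 0 j)) :
    (Matrix.of fun i j => ∫ s in Set.Ioi (0 : ℝ), ((G s)ᵀ * G s) i j :
      Matrix (Fin p) (Fin p) ℝ).PosSemidef := by
  have hent : ∀ s i j, ((G s)ᵀ * G s) i j = G s 0 i * G s 0 j := by
    intro s i j; simp [Matrix.mul_apply]
  simp only [hent]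
  have hint : ∀ i j, IntegrableOn (fun s => G s 0 i * G s 0 j) (Set.Ioi 0) := by
    intro i j
    obtain ⟨ε, hε, h⟩ := (hd i).mul (hd j)
    refine integrable_of_isBigO_exp_neg hε (Continuous.continuousOn ?_) h
    exact (hG.matrix_elem 0 i).mul (hG.matrix_elem 0 j)
  refine Matrix.PosSemidef.of_dotProduct_mulVec_nonneg ?_ fun v => ?_
  · ext i j
    simp [mul_comm]
  · have : star v ⬝ᵥ ((Matrix.of fun i j => ∫ s in Set.Ioi (0 : ℝ), G s 0 i * G s 0 j) *ᵥ v) =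
        ∫ s in Set.Ioi (0 : ℝ), (∑ i, v i * G s 0 i) ^ 2 := by
      have e : ∀ s, (∑ i, v i * G s 0 i) ^ 2 = ∑ i, ∑ j, (v i * v j) * (G s 0 i * G s 0 j) := by
        intro s
        rw [sq, Finset.sum_mul_sum]
        refine Finset.sum_congr rfl fun i _ => Finset.sum_congr rfl fun j _ => by ring
      simp_rw [e]
      rw [integral_finsetSum _ fun i _ => integrable_finsetSum _ fun j _ => (hint i j).const_mul _]
      simp only [dotProduct, mulVec, Matrix.of_apply, Finset.mul_sum, star_trivial]
      refine Finset.sum_congr rfl fun i _ => ?_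
      rw [integral_finsetSum _ fun j _ => (hint i j).const_mul _]
      refine Finset.sum_congr rfl fun j _ => ?_
      rw [integral_const_mul]; ring
    rw [this]
    exact integral_nonneg fun s => sq_nonneg _

lemma mexp_negT {p : ℕ} (A : Matrix (Fin p) (Fin p) ℝ) (s : ℝ) :
    mexp (-(s • Aᵀ)) = (mexp (-(s • A)))ᵀ := by
  rw [← mexp_transpose]; simp

lemma psd_Q {p : ℕ} (A : Matrix (Fin p) (Fin p) ℝ) (C : Matrix (Fin 1) (Fin p) ℝ)
    (hA : EigPos A) : (Qmat A C).PosSemidef := by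
  have := psd_int (fun s => C * mexp (-(s • A))) (continuous_const.matrix_mul (cont_mexp A))
    (fun j => by
      simp only [Matrix.mul_apply]
      exact Dec.sum _ fun i => (dec_mexp A hA i j).const_mul _)
  simpa only [Qmat, mexp_negT, Matrix.transpose_mul, Matrix.mul_assoc] using this

lemma psd_N {p : ℕ} (A : Matrix (Fin p) (Fin p) ℝ) (B : Matrix (Fin p) (Fin 1) ℝ)
    (hA : EigPos A) : (Nmat A B).PosSemidef := by
  have := psd_int (fun s => (mexp (-(s • A)) * B)ᵀ)
    ((cont_mexp A).matrix_mul continuous_const).matrix_transpose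
    (fun j => by
      simp only [Matrix.transpose_apply, Matrix.mul_apply, mul_comm _ (B _ _)]
      exact Dec.sum _ fun i => (dec_mexp A hA j i).const_mul _)
  simpa only [Nmat, mexp_negT, Matrix.transpose_mul, Matrix.transpose_transpose,
    Matrix.mul_assoc] using this

lemma psd_calN {p : ℕ} (A : Matrix (Fin p) (Fin p) ℝ) (B : Matrix (Fin p) (Fin 1) ℝ)
    (hA : EigPos A) (x : ℝ) : (calN A B x).PosSemidef := by
  have := (psd_N A B hA).mul_mul_conjTranspose_same (mexp (-(x • A)))
  simpa only [calN, mexp_negT, conjTranspose_eq_transpose_of_trivial] using this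

lemma commute_mexp {p : ℕ} {X Y : Matrix (Fin p) (Fin p) ℝ} (h : Commute X Y) :
    Commute (mexp X) (mexp Y) := by
  rw [mexp_eq, mexp_eq]; exact h.exp

lemma psd_calQ {p : ℕ} (A : Matrix (Fin p) (Fin p) ℝ) (C : Matrix (Fin 1) (Fin p) ℝ)
    (hA : EigPos A) (x t : ℝ) : (calQ A C x t).PosSemidef := by
  have h3 : mexp ((8 * t) • Aᵀ ^ 3) = (mexp ((8 * t) • A ^ 3))ᵀ := by
    rw [← mexp_transpose]; simp
  have hc : Commute (mexp (-(x • A))) (mexp ((8 * t) • A ^ 3)) :=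
    commute_mexp ((((Commute.refl A).pow_right 3).smul_left x).neg_left.smul_right _)
  have := (psd_Q A C hA).conjTranspose_mul_mul_same (mexp (-(x • A)) * mexp ((8 * t) • A ^ 3))
  rw [calQ, mexp_negT, h3, ← Matrix.transpose_mul, ← hc.eq]
  simpa only [conjTranspose_eq_transpose_of_trivial, Matrix.mul_assoc] using this

lemma isUnit_one_add {p : ℕ} {Q N : Matrix (Fin p) (Fin p) ℝ} (hQ : Q.PosSemidef)
    (hN : N.PosSemidef) : IsUnit (1 + Q * N) := by
  rw [← Matrix.mulVec_injective_iff_isUnit]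
  have : Function.Injective ((1 + Q * N).mulVecLin) := by
    rw [injective_iff_map_eq_zero]
    intro v hv
    have hv' : v = - (Q *ᵥ (N *ᵥ v)) := by
      rw [Matrix.mulVecLin_apply, Matrix.add_mulVec, Matrix.one_mulVec, ← Matrix.mulVec_mulVec] at hv
      exact eq_neg_of_add_eq_zero_left hv
    have h1 := hQ.dotProduct_mulVec_nonneg (N *ᵥ v)
    have h2 := hN.dotProduct_mulVec_nonneg v
    have h3 : star v ⬝ᵥ N *ᵥ v = - (star (N *ᵥ v) ⬝ᵥ Q *ᵥ (N *ᵥ v)) := by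
      rw [← dotProduct_neg, ← hv', star_trivial, star_trivial, dotProduct_comm]
    have h4 : N *ᵥ v = 0 := (hN.dotProduct_mulVec_zero_iff v).1 (by linarith)
    rw [hv', h4]; simp
  exact this

open scoped Matrix.Norms.Operator in
lemma deriv_Gam_inv {p : ℕ} (A : Matrix (Fin p) (Fin p) ℝ)
    (B : Matrix (Fin p) (Fin 1) ℝ) (C : Matrix (Fin 1) (Fin p) ℝ) (x t : ℝ)
    (hu : IsUnit (Gam A B C x t)) :
    HasDerivAt (fun ξ : ℝ => (Gam A B C ξ t)⁻¹)
      ((Gam A B C x t)⁻¹ * Aᵀ + Aᵀ * (Gam A B C x t)⁻¹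
            - (2 : ℝ) • ((Gam A B C x t)⁻¹ * (Aᵀ - calQ A C x t * A * calN A B x)
              * (Gam A B C x t)⁻¹)) x := by
  have cA : ∀ (M : Matrix (Fin p) (Fin p) ℝ) (s : ℝ), M * mexp (-(s • M)) = mexp (-(s • M)) * M := by
    intro M s
    rw [mexp_eq]
    exact (((Commute.refl M).smul_right s).neg_right.exp_right).eq
  have cA3 : A * mexp ((8 * t) • A ^ 3) = mexp ((8 * t) • A ^ 3) * A := by
    rw [mexp_eq]
    exact ((((Commute.refl A).pow_right 3).smul_right (8 * t)).exp_right).eq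
  have dQ : HasDerivAt (fun ξ => calQ A C ξ t) (-(Aᵀ * calQ A C x t) - calQ A C x t * A) x := by
    have := ((((hasDeriv_mexp Aᵀ x).mul_const (mexp ((8 * t) • Aᵀ ^ 3))).mul_const (Qmat A C)).mul
      (hasDeriv_mexp A x)).mul_const (mexp ((8 * t) • A ^ 3))
    refine this.congr_deriv ?_
    simp only [calQ]
    rw [cA A x]
    simp only [neg_mul, mul_neg, add_mul, Matrix.mul_assoc, cA3]
    abel
  have dN : HasDerivAt (fun ξ => calN A B ξ) (-(A * calN A B x) - calN A B x * Aᵀ) x := by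
    have := ((hasDeriv_mexp A x).mul_const (Nmat A B)).mul (hasDeriv_mexp Aᵀ x)
    refine this.congr_deriv ?_
    simp only [calN]
    rw [cA Aᵀ x]
    simp only [neg_mul, mul_neg, Matrix.mul_assoc]
    abel
  have dG : HasDerivAt (fun ξ => Gam A B C ξ t)
      ((-(Aᵀ * calQ A C x t) - calQ A C x t * A) * calN A B x +
        calQ A C x t * (-(A * calN A B x) - calN A B x * Aᵀ)) x := (dQ.mul dN).const_add 1
  obtain ⟨u, hu⟩ := hu
  have hinv : (Gam A B C x t)⁻¹ = (↑u⁻¹ : Matrix (Fin p) (Fin p) ℝ) := by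
    rw [← hu, Matrix.nonsing_inv_eq_ringInverse, Ring.inverse_unit]
  have dI := hasFDerivAt_ringInverse (𝕜 := ℝ) u
  rw [hu] at dI
  have := dI.comp_hasDerivAt x dG
  simp only [Matrix.nonsing_inv_eq_ringInverse] at hinv ⊢
  refine HasDerivAt.congr_deriv this ?_
  rw [hinv]
  have hQN : calQ A C x t * calN A B x = ↑u - 1 := by rw [hu, Gam]; abel
  have hQN' : (-(Aᵀ * calQ A C x t) - calQ A C x t * A) * calN A B x +
        calQ A C x t * (-(A * calN A B x) - calN A B x * Aᵀ) =
      -(Aᵀ * (↑u - 1)) - (2 : ℝ) • (calQ A C x t * A * calN A B x) - (↑u - 1) * Aᵀ := by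
    rw [← hQN, two_smul]; noncomm_ring
  rw [hQN']
  generalize calQ A C x t * A * calN A B x = Z
  simp only [_root_.neg_apply, ContinuousLinearMap.mulLeftRight_apply, two_smul,
    mul_sub, sub_mul, mul_neg, neg_mul, mul_add, add_mul, mul_one, one_mul]
  simp only [mul_assoc, Units.mul_inv, Units.inv_mul_cancel_left, mul_one]
  abel

theorem statement6 {p : ℕ} (hp : 0 < p) (A : Matrix (Fin p) (Fin p) ℝ)
    (B : Matrix (Fin p) (Fin 1) ℝ) (C : Matrix (Fin 1) (Fin p) ℝ)
    (hA : EigPos A) (hobs : Observable A C) (hctrl : Controllable A B) :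
    ∀ x t : ℝ,
      IsUnit (Gam A B C x t) ∧
      ∀ i j : Fin p,
        HasDerivAt (fun ξ : ℝ => (Gam A B C ξ t)⁻¹ i j)
          (((Gam A B C x t)⁻¹ * Aᵀ + Aᵀ * (Gam A B C x t)⁻¹
            - (2 : ℝ) • ((Gam A B C x t)⁻¹ * (Aᵀ - calQ A C x t * A * calN A B x)
              * (Gam A B C x t)⁻¹)) i j) x := by
  intro x t
  have hu : IsUnit (Gam A B C x t) :=
    isUnit_one_add (psd_calQ A C hA x t) (psd_calN A B hA x)
  refine ⟨hu, fun i j => ?_⟩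
  open scoped Matrix.Norms.Operator in
  have h := deriv_Gam_inv A B C x t hu
  exact hasDerivAt_pi.1 (hasDerivAt_pi.1 h i) j
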